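/- arXiv:1707.08864 — 3 statements merged into one kernel-verified Lean document; each statement's English description precedes it below -/
import Mathlib

section
/- Let R be a ring with unity, G a good monoid, and M = ((M_g)_{g∈G}, (φ_{g₁,g₂})) a generalized algebraic persistence module over R of finite type. Then every sequence in M becomes stationary; that is, for every sequence (g_i)_{i∈ℕ} in G with g_i ⪯ g_{i+1} for all i, there exists D ∈ ℕ such that φ_{g_i,g_{i+1}} is an isomorphism for all i ≥ D. -/
open CategoryTheory DirectSum

universe u v w

/-- Left-divisibility: `g₁ ⪯ g₂` iff `g₂` is a left multiple of `g₁`. -/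
def DvdL {G : Type w} [Monoid G] (g₁ g₂ : G) : Prop := ∃ h, h * g₁ = g₂

lemma DvdL.refl {G : Type w} [Monoid G] (g : G) : DvdL g g := ⟨1, one_mul g⟩

lemma DvdL.trans {G : Type w} [Monoid G] {a b c : G} : DvdL a b → DvdL b c → DvdL a c
  | ⟨h₁, e₁⟩, ⟨h₂, e₂⟩ => ⟨h₂ * h₁, by rw [mul_assoc, e₁, e₂]⟩

/-- `m` is a common (left-)multiple of the set `S`. -/
def IsCommonMultiple {G : Type w} [Monoid G] (S : Set G) (m : G) : Prop := ∀ g ∈ S, DvdL g m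

/-- `m` is a partially least common multiple of `S`. -/
def IsPlcm {G : Type w} [Monoid G] (S : Set G) (m : G) : Prop :=
  IsCommonMultiple S m ∧ ∀ m', IsCommonMultiple S m' → DvdL m' m → m' = m

/-- A good monoid: cancellative, anti-symmetric and weak plcm. -/
structure IsGoodMonoid (G : Type w) [Monoid G] : Prop where
  mul_right_cancel : ∀ g₁ g₂ g₃ : G, g₁ * g₃ = g₂ * g₃ → g₁ = g₂
  mul_left_cancel : ∀ g₁ g₂ g₃ : G, g₁ * g₂ = g₁ * g₃ → g₂ = g₃
  antisymm : ∀ g₁ g₂ : G, DvdL g₁ g₂ → DvdL g₂ g₁ → g₁ = g₂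
  weak_plcm : ∀ S : Set G, S.Finite → {m | IsPlcm S m}.Finite

/-- A module is finitely presented if there is a surjection from a finitely generated
free module with finitely generated kernel. -/
def IsFinitelyPresented (A : Type*) (M : Type*) [Ring A] [AddCommGroup M] [Module A M] : Prop :=
  ∃ (n : ℕ) (μ : (Fin n → A) →ₗ[A] M), Function.Surjective μ ∧ (LinearMap.ker μ).FG

/-- A generalized algebraic persistence module over `R` indexed by the monoid `G`. -/
structure GAPM (R : Type u) [Ring R] (G : Type w) [Monoid G] :
    Type (max u w (v + 1)) where
  M : G → Type v
  [acg : ∀ g, AddCommGroup (M g)]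
  [mod : ∀ g, Module R (M g)]
  φ : ∀ {g₁ g₂ : G}, DvdL g₁ g₂ → (M g₁ →ₗ[R] M g₂)
  φ_id : ∀ (g : G) (x : M g), φ (DvdL.refl g) x = x
  φ_comp : ∀ {g₁ g₂ g₃ : G} (h₁₂ : DvdL g₁ g₂) (h₂₃ : DvdL g₂ g₃) (x : M g₁),
      φ h₂₃ (φ h₁₂ x) = φ (h₁₂.trans h₂₃) x

attribute [instance] GAPM.acg GAPM.mod

variable {R : Type u} [Ring R] {G : Type w} [Monoid G]

/-- `h` is a frame of `g`. -/
def GAPM.IsFrame (X : GAPM.{u, v, w} R G) (h g : G) : Prop :=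
  DvdL h g ∧ ∀ (g' : G) (d : DvdL h g'), DvdL g' g → Function.Bijective (X.φ d)

/-- Finite type: there is a finite framing set. -/
def GAPM.FiniteType (X : GAPM.{u, v, w} R G) : Prop :=
  ∃ H : Finset G, ∀ g : G, ∃ h ∈ H, X.IsFrame h g

def GAPM.FPType (X : GAPM.{u, v, w} R G) : Prop :=
  X.FiniteType ∧ ∀ g, IsFinitelyPresented R (X.M g)

def GAPM.FGType (X : GAPM.{u, v, w} R G) : Prop :=
  X.FiniteType ∧ ∀ g, Module.Finite R (X.M g)


/-- Over a good monoid, every sequence in a generalized persistence module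
of finite type becomes stationary. -/
theorem finite_type_sequences_stationary (hG : IsGoodMonoid G) (X : GAPM.{u, v, w} R G)
    (hX : X.FiniteType) (g : ℕ → G) (hg : ∀ i : ℕ, DvdL (g i) (g (i + 1))) :
    ∃ D : ℕ, ∀ i : ℕ, D ≤ i → Function.Bijective (X.φ (hg i)) := by
  obtain ⟨H, hH⟩ := hX
  choose f hfH hf using fun i => hH (g i)
  have mono : ∀ i j : ℕ, i ≤ j → DvdL (g i) (g j) := by
    intro i j hij
    induction j, hij using Nat.le_induction with
    | base => exact DvdL.refl _
    | succ k _ ih => exact ih.trans (hg k)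
  -- some `h` in `H` frames `g i` for infinitely many `i`
  obtain ⟨h, hinf⟩ : ∃ h : H, Infinite ((fun i => (⟨f i, hfH i⟩ : H)) ⁻¹' {h}) :=
    Finite.exists_infinite_fiber _
  have hset := Set.infinite_coe_iff.mp hinf
  obtain ⟨D, hD⟩ := hset.nonempty
  have hD' : f D = h := congrArg Subtype.val hD
  have hdvd : ∀ i, D ≤ i → DvdL (h : G) (g i) := fun i hi =>
    DvdL.trans (hD' ▸ (hf D).1) (mono D i hi)
  have bij : ∀ i (hi : D ≤ i), Function.Bijective (X.φ (hdvd i hi)) := by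
    intro i hi
    obtain ⟨j, hj, hij⟩ := hset.exists_gt i
    have hj' : f j = h := congrArg Subtype.val hj
    have hfr : X.IsFrame h (g j) := hj' ▸ hf j
    exact hfr.2 (g i) _ (mono i j hij.le)
  refine ⟨D, fun i hi => ?_⟩
  have hcomp : (X.φ (hg i)) ∘ (X.φ (hdvd i hi)) = X.φ (hdvd (i + 1) (by omega)) :=
    funext fun x => X.φ_comp _ _ x
  have hb := bij (i + 1) (by omega)
  rw [← hcomp] at hb
  exact (Function.Bijective.of_comp_iff _ (bij i hi)).mp hb
end

section
/- Let R be a ring with unity, k ∈ ℕ, and M = ((M_g)_{g∈ℕ^k}, (φ_{g₁,g₂})) a generalized algebraic persistence module over R indexed by the monoid (ℕ^k, +). Then M is of finite type if and only if every sequence in M becomes stationary, i.e., for every sequence (g_i)_{i∈ℕ} in ℕ^k with g_i ⪯ g_{i+1} for all i there exists D ∈ ℕ such that φ_{g_i,g_{i+1}} is an isomorphism for all i ≥ D. -/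
open CategoryTheory DirectSum

universe u v w

variable {R : Type u} [Ring R] {G : Type w} [Monoid G]

theorem dvdL_iff_aux {k : ℕ} (a b : Multiplicative (Fin k → ℕ)) :
    DvdL a b ↔ Multiplicative.toAdd a ≤ Multiplicative.toAdd b := by
  constructor
  · rintro ⟨h, rfl⟩
    rw [toAdd_mul]
    exact le_add_of_nonneg_left zero_le
  · intro h
    refine ⟨Multiplicative.ofAdd (Multiplicative.toAdd b - Multiplicative.toAdd a), ?_⟩
    apply Multiplicative.toAdd.injective
    rw [toAdd_mul, toAdd_ofAdd]
    exact tsub_add_cancel_of_le h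

theorem dvdL_seq_aux {G : Type w} [Monoid G] (g : ℕ → G)
    (hg : ∀ i : ℕ, DvdL (g i) (g (i + 1))) {i j : ℕ} (hij : i ≤ j) : DvdL (g i) (g j) := by
  induction hij with
  | refl => exact DvdL.refl _
  | step _ ih => exact ih.trans (hg _)

theorem stationary_of_finiteType_aux {R : Type u} [Ring R] {G : Type w} [Monoid G]
    (X : GAPM.{u, v, w} R G) (hX : X.FiniteType) (g : ℕ → G)
    (hg : ∀ i : ℕ, DvdL (g i) (g (i + 1))) :
    ∃ D : ℕ, ∀ i : ℕ, D ≤ i → Function.Bijective (X.φ (hg i)) := by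
  obtain ⟨H, hH⟩ := hX
  choose f hfH hf using fun i => hH (g i)
  obtain ⟨h, hh⟩ := Finite.exists_infinite_fiber (fun i => (⟨f i, hfH i⟩ : H))
  have hinf : Set.Infinite {i | f i = h.1} := by
    have := Set.infinite_coe_iff.mp hh
    refine this.mono ?_
    intro i hi
    exact congrArg Subtype.val hi
  obtain ⟨D, hD⟩ := hinf.nonempty
  refine ⟨D, fun i hi => ?_⟩
  obtain ⟨j, hj, hij⟩ := hinf.exists_gt i
  have d0 : DvdL h.1 (g D) := by
    have := (hf D).1
    rwa [show f D = h.1 from hD] at this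
  have fr : X.IsFrame h.1 (g j) := by
    have := hf j
    rwa [show f j = h.1 from hj] at this
  have d1 : DvdL h.1 (g i) := d0.trans (dvdL_seq_aux g hg hi)
  have b1 := fr.2 _ d1 (dvdL_seq_aux g hg hij.le)
  have b2 := fr.2 _ (d1.trans (hg i)) (dvdL_seq_aux g hg hij)
  have e : (X.φ (hg i)) ∘ (X.φ d1) = X.φ (d1.trans (hg i)) := by
    funext x
    exact X.φ_comp d1 (hg i) x
  rw [← e] at b2
  exact (Function.Bijective.of_comp_iff _ b1).mp b2

/-- Over `ℕᵏ`, a generalized persistence module is of finite type if and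
only if every sequence in it becomes stationary. -/
theorem finite_type_iff_sequences_stationary (k : ℕ)
    (X : GAPM.{u, v} R (Multiplicative (Fin k → ℕ))) :
    X.FiniteType ↔ ∀ (g : ℕ → Multiplicative (Fin k → ℕ))
      (hg : ∀ i : ℕ, DvdL (g i) (g (i + 1))),
      ∃ D : ℕ, ∀ i : ℕ, D ≤ i → Function.Bijective (X.φ (hg i)) := by
  constructor
  · intro hX g hg
    exact stationary_of_finiteType_aux X hX g hg
  · intro hst
    by_contra hX
    have hX' : ∀ H : Finset (Multiplicative (Fin k → ℕ)), ∃ g, ∀ h ∈ H, ¬ X.IsFrame h g := by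
      intro H
      by_contra hcon
      push Not at hcon
      exact hX ⟨H, hcon⟩
    obtain ⟨f, -, hf⟩ := exists_seq_of_forall_finset_exists (fun _ => True)
      (fun h g => ¬ X.IsFrame h g) (fun s _ => by
        obtain ⟨y, hy⟩ := hX' s
        exact ⟨y, trivial, hy⟩)
    obtain ⟨n, hn⟩ := (wellQuasiOrdered_le (α := Fin k → ℕ)).exists_monotone_subseq
      (fun i => Multiplicative.toAdd (f i))
    have hd : ∀ i, DvdL (f (n i)) (f (n (i + 1))) := fun i =>
      (dvdL_iff_aux _ _).mpr (hn _ _ (Nat.le_succ i))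
    have hmid : ∀ i, ∃ m, ∃ d : DvdL (f (n i)) m, DvdL m (f (n (i + 1))) ∧
        ¬ Function.Bijective (X.φ d) := by
      intro i
      by_contra hcon
      push Not at hcon
      exact hf (n i) (n (i + 1)) (n.strictMono (Nat.lt_succ_self i)) ⟨hd i, hcon⟩
    choose m d1 d2 hm using hmid
    let g : ℕ → Multiplicative (Fin k → ℕ) :=
      fun j => if j % 2 = 0 then f (n (j / 2)) else m (j / 2)
    have g0 : ∀ i, g (2 * i) = f (n i) := fun i => by simp [g]
    have g1 : ∀ i, g (2 * i + 1) = m i := fun i => by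
      have e1 : (2 * i + 1) % 2 = 1 := by omega
      have e2 : (2 * i + 1) / 2 = i := by omega
      simp [g, e1, e2]
    have hg : ∀ j, DvdL (g j) (g (j + 1)) := by
      intro j
      obtain ⟨i, rfl | rfl⟩ := j.even_or_odd'
      · rw [g0, g1]; exact d1 i
      · rw [g1, show 2 * i + 1 + 1 = 2 * (i + 1) by ring, g0]; exact d2 i
    obtain ⟨D, hD⟩ := hst g hg
    have key : ∀ {a b a' b' : Multiplicative (Fin k → ℕ)} (h : DvdL a b) (h' : DvdL a' b'),
        a = a' → b = b' → Function.Bijective (X.φ h) → Function.Bijective (X.φ h') := by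
      rintro a b _ _ h h' rfl rfl hb
      exact hb
    exact hm D (key (hg (2 * D)) (d1 D) (g0 D) (g1 D) (hD (2 * D) (by omega)))
end

section
/- Let R be a nonzero ring with unity and consider the generalized algebraic persistence module M over R indexed by the monoid (ℚ_{≥0}, +) defined by M_0 := R, M_q := 0 for all q > 0, with all structure maps φ_{q₁,q₂} for q₁ < q₂ equal to zero. Then every sequence in M becomes stationary, but M is not of finite type, i.e., no finite subset of ℚ_{≥0} is a framing set for M. -/
open CategoryTheory DirectSum

universe u v w

variable {R : Type u} [Ring R] {G : Type w} [Monoid G]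

/-- The submodule `R` at index `0` and `0` elsewhere. -/
noncomputable def S11 (R : Type u) [Ring R] (q : Multiplicative NNRat) : Submodule R R :=
  if q = 1 then ⊤ else ⊥

lemma dvdL_one {q₂ q₃ : Multiplicative NNRat} (d : DvdL q₂ q₃) (h : q₃ = 1) : q₂ = 1 := by
  obtain ⟨c, hc⟩ := d
  have : c.toAdd + q₂.toAdd = 0 := by
    have := congrArg Multiplicative.toAdd (hc.trans h)
    simpa using this
  have h2 : q₂.toAdd = 0 := by
    rcases (add_eq_zero_iff_of_nonneg (by positivity) (by positivity)).mp this with ⟨_, h2⟩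
    exact h2
  exact Multiplicative.toAdd.injective (by simpa using h2)

lemma S11_eq_zero {R : Type u} [Ring R] {q : Multiplicative NNRat} (h : ¬ q = 1) {v : R}
    (hv : v ∈ S11 R q) : v = 0 := by
  rw [show S11 R q = ⊥ from if_neg h] at hv
  exact (Submodule.mem_bot R).mp hv

/-- The persistence module over `ℚ≥0` with `M_0 = R`, `M_q = 0` for `q > 0`,
and zero structure maps between distinct indices. -/
noncomputable def gapm11 (R : Type u) [Ring R] : GAPM.{u, u} R (Multiplicative NNRat) where
  M q := S11 R q
  φ {q₁ q₂} d :=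
    { toFun := fun x => ⟨if q₂ = 1 then x.1 else 0, by
        by_cases h : q₂ = 1 <;> simp [S11, h]⟩
      map_add' := fun x y => by
        apply Subtype.ext
        by_cases h : q₂ = 1 <;> simp [h]
      map_smul' := fun r x => by
        apply Subtype.ext
        by_cases h : q₂ = 1 <;> simp [h] }
  φ_id q x := by
    apply Subtype.ext
    by_cases h : q = 1
    · simp [h]
    · have hx : x.1 = 0 := S11_eq_zero h x.2
      simp [h, hx]
  φ_comp {q₁ q₂ q₃} h12 h23 x := by
    apply Subtype.ext
    by_cases h : q₃ = 1
    · simp [h, dvdL_one h23 h]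
    · simp [h]


lemma dvdL_le {a b : Multiplicative NNRat} (d : DvdL a b) : a.toAdd ≤ b.toAdd := by
  obtain ⟨c, rfl⟩ := d
  rw [toAdd_mul]
  exact le_add_of_nonneg_left zero_le

lemma gapm11_val (R : Type u) [Ring R] {a b : Multiplicative NNRat} (d : DvdL a b)
    (x : S11 R a) : (show S11 R b from (gapm11 R).φ d x).1 = if b = 1 then x.1 else 0 := rfl

lemma gapm11_bij_of_ne (R : Type u) [Ring R] {a b : Multiplicative NNRat} (d : DvdL a b)
    (ha : a ≠ 1) : Function.Bijective ((gapm11 R).φ d) := by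
  have hb : b ≠ 1 := fun h => ha (dvdL_one d h)
  refine ⟨fun x y _ => ?_, fun y => ⟨0, ?_⟩⟩
  · exact Subtype.ext ((S11_eq_zero ha (Subtype.prop (p := (· ∈ S11 R a)) x)).trans
      (S11_eq_zero ha (Subtype.prop (p := (· ∈ S11 R a)) y)).symm)
  · rw [map_zero]
    exact Subtype.ext (S11_eq_zero hb (Subtype.prop (p := (· ∈ S11 R b)) y)).symm

lemma gapm11_bij_of_one (R : Type u) [Ring R] {a b : Multiplicative NNRat} (d : DvdL a b)
    (hb : b = 1) : Function.Bijective ((gapm11 R).φ d) := by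
  have ha := dvdL_one d hb
  subst hb
  subst ha
  have : ((gapm11 R).φ d : (gapm11 R).M 1 → (gapm11 R).M 1) = id :=
    funext fun x => (gapm11 R).φ_id 1 x
  rw [this]
  exact Function.bijective_id

lemma exists_small (H : Finset (Multiplicative NNRat)) :
    ∃ g : NNRat, 0 < g ∧ ∀ h ∈ H, h ≠ 1 → g < h.toAdd := by
  classical
  induction H using Finset.induction_on with
  | empty => exact ⟨1, one_pos, by simp⟩
  | insert a s _ ih =>
    obtain ⟨g, hg, hs⟩ := ih
    by_cases ha : a = 1
    · refine ⟨g, hg, fun h hh h1 => ?_⟩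
      rcases Finset.mem_insert.mp hh with rfl | hh
      · exact absurd ha h1
      · exact hs h hh h1
    · have hpos : 0 < a.toAdd := pos_iff_ne_zero.mpr fun h => ha (toAdd_eq_zero.mp h)
      refine ⟨min g (a.toAdd / 2), lt_min hg (half_pos hpos), fun h hh h1 => ?_⟩
      rcases Finset.mem_insert.mp hh with rfl | hh
      · exact (min_le_right _ _).trans_lt (half_lt_self hpos)
      · exact (min_le_left _ _).trans_lt (hs h hh h1)

/-- For the persistence module over `ℚ≥0` with `M₀ = R`, `M_q = 0` for
`q > 0` and zero structure maps, every sequence becomes stationary but the module is not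
of finite type. -/
theorem sequences_stationary_but_not_finite_type (R : Type u) [Ring R] [Nontrivial R] :
    (∀ (q : ℕ → Multiplicative NNRat) (hq : ∀ i : ℕ, DvdL (q i) (q (i + 1))),
      ∃ D : ℕ, ∀ i : ℕ, D ≤ i → Function.Bijective ((gapm11 R).φ (hq i))) ∧
    ¬ (gapm11 R).FiniteType := by
  constructor
  · intro q hq
    by_cases h : ∃ i, q i ≠ 1
    · obtain ⟨D, hD⟩ := h
      refine ⟨D, fun i hi => gapm11_bij_of_ne R _ ?_⟩
      induction i, hi using Nat.le_induction with
      | base => exact hD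
      | succ n _ ih => exact fun h => ih (dvdL_one (hq n) h)
    · push Not at h
      exact ⟨0, fun i _ => gapm11_bij_of_one R _ (h _)⟩
  · rintro ⟨H, hH⟩
    obtain ⟨g, hg, hs⟩ := exists_small H
    obtain ⟨h, hh, hd, hf⟩ := hH (Multiplicative.ofAdd g)
    have h1 : h = 1 := by
      by_contra h1
      exact absurd (dvdL_le hd) (not_le.mpr (hs h hh h1))
    subst h1
    have hg1 : Multiplicative.ofAdd g ≠ 1 := fun e => hg.ne' (ofAdd_eq_one.mp e)
    have hinj := (hf _ hd (DvdL.refl _)).1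
    let x : S11 R 1 := ⟨1, by simp [S11]⟩
    let z : S11 R 1 := 0
    have hxz : x = z := hinj (Subtype.ext
      ((gapm11_val R hd x).trans ((if_neg hg1).trans
        ((gapm11_val R hd z).trans (if_neg hg1)).symm)))
    exact one_ne_zero (α := R) (congrArg Subtype.val hxz)
end
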